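/- Let λ be a nonzero real number, let k ≥ 1 be an integer, and let x be a real number with |x| < 1. Then the series Σ_{n=1}^∞ ( Σ_{l=1}^n (l)_{k,λ} · H_{l,λ} ) · x^n converges absolutely and equals (1/(1−x)^2) · ( HF_{k,λ}(x/(1−x)) − log_λ(1−x) · F^{(1−λ)}_{k,λ}(x/(1−x)) ), where log_λ(1−x) = ((1−x)^λ − 1)/λ. -/

import Mathlib

open Finset

/-- The degenerate falling factorial `(x)_{n,λ} = x(x-λ)⋯(x-(n-1)λ)`. -/
noncomputable def degFall (lam x : ℝ) (n : ℕ) : ℝ := ∏ i ∈ Finset.range n, (x - (i : ℝ) * lam)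

/-- The ordinary falling factorial `(x)_n = x(x-1)⋯(x-n+1)`. -/
noncomputable def fall (x : ℝ) (n : ℕ) : ℝ := ∏ i ∈ Finset.range n, (x - (i : ℝ))

/-- The rising factorial `⟨a⟩_k = a(a+1)⋯(a+k-1)`. -/
noncomputable def rising (a : ℝ) (k : ℕ) : ℝ := ∏ i ∈ Finset.range k, (a + (i : ℝ))

/-- The generalized binomial coefficient `binom(a,k) = a(a-1)⋯(a-k+1)/k!`. -/
noncomputable def rchoose (a : ℝ) (k : ℕ) : ℝ :=
  (∏ i ∈ Finset.range k, (a - (i : ℝ))) / (k.factorial : ℝ)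

/-- The degenerate harmonic numbers `H_{n,λ} = Σ_{k=1}^n (1/k)·binom(k-1-λ, k-1)`. -/
noncomputable def degH (lam : ℝ) (n : ℕ) : ℝ :=
  ∑ k ∈ Finset.Icc 1 n, (1 / (k : ℝ)) * rchoose ((k : ℝ) - 1 - lam) (k - 1)

/-- The degenerate hyperharmonic numbers `H^{(r)}_{n,λ}`. -/
noncomputable def degHyperH (lam : ℝ) : ℕ → ℕ → ℝ
  | 0, _ => 0
  | 1, n => degH lam n
  | r + 2, n => ∑ k ∈ Finset.Icc 1 n, degHyperH lam (r + 1) k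

/-- The degenerate harmonic-Fubini polynomial built from degenerate Stirling numbers `S2`. -/
noncomputable def HFpoly (lam : ℝ) (S2 : ℕ → ℕ → ℝ) (n : ℕ) (x : ℝ) : ℝ :=
  ∑ k ∈ Finset.Icc 1 n, S2 n k * degH lam k * (k.factorial : ℝ) * x ^ k

/-- The degenerate Fubini polynomial of order `1-λ` built from degenerate Stirling numbers `S2`. -/
noncomputable def Fpoly (lam : ℝ) (S2 : ℕ → ℕ → ℝ) (n : ℕ) (x : ℝ) : ℝ :=
  ∑ k ∈ Finset.range (n + 1), rising (1 - lam) k * S2 n k * x ^ k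

/-- The degenerate hyperharmonic-Fubini polynomial built from degenerate Stirling numbers `S2`. -/
noncomputable def HFpolyR (lam : ℝ) (S2 : ℕ → ℕ → ℝ) (r n : ℕ) (y : ℝ) : ℝ :=
  ∑ k ∈ Finset.Icc 1 n, S2 n k * degHyperH lam r k * (k.factorial : ℝ) * y ^ k

/-- The degenerate falling factorial power of the operator `θ = x·d/dx`:
`(θ)_{k,λ} = (θ - (k-1)λ) ∘ ⋯ ∘ (θ - λ) ∘ θ`. -/
noncomputable def thetaFall (lam : ℝ) : ℕ → (ℝ → ℝ) → ℝ → ℝ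
  | 0, g => g
  | k + 1, g => fun x => x * deriv (thetaFall lam k g) x - (k : ℝ) * lam * thetaFall lam k g x

theorem rising_succ (a : ℝ) (n : ℕ) : rising a (n + 1) = rising a n * (a + n) := by
  simp [rising, Finset.prod_range_succ]

theorem rising_add (a : ℝ) (m n : ℕ) : rising a (m + n) = rising a m * rising (a + m) n := by
  simp [rising, Finset.prod_range_add, add_assoc]

theorem rising_one (n : ℕ) : rising 1 n = n.factorial := by
  induction n with
  | zero => simp [rising]
  | succ n ih => rw [rising_succ, ih, Nat.factorial_succ]; push_cast; ring

theorem rising_div_factorial (a : ℝ) (n : ℕ) :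
    rising a n / n.factorial = Ring.choose (a + n - 1) n := by
  have h : rising a n = (ascPochhammer ℝ n).eval a := by
    induction n with
    | zero => simp [rising]
    | succ n ih => rw [rising_succ, ascPochhammer_succ_eval, ih]
  rw [h, ← Polynomial.ascPochhammer_smeval_eq_eval,
    ← Ring.factorial_nsmul_multichoose_eq_ascPochhammer, nsmul_eq_mul, Ring.multichoose_eq]
  field_simp

theorem fall_natCast (n k : ℕ) : fall (n : ℝ) k = n.descFactorial k := by
  rw [← descPochhammer_eval_eq_descFactorial, descPochhammer_eval_eq_prod_range, fall]

/-- The binomial series `∑ ⟨a⟩_n xⁿ / n! = (1 - x)^(-a)`. -/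
theorem hasSum_rising_div_factorial (a : ℝ) {x : ℝ} (hx : |x| < 1) :
    HasSum (fun n : ℕ => rising a n / n.factorial * x ^ n) ((1 - x) ^ (-a)) := by
  have h := (Real.one_div_one_sub_rpow_hasFPowerSeriesOnBall_zero a).hasSum (y := x)
    (by simpa [enorm_eq_nnnorm, ← NNReal.coe_lt_coe] using hx)
  have h1 : 0 ≤ 1 - x := by linarith [(abs_lt.mp hx).2]
  rw [Real.rpow_neg h1]
  simpa [FormalMultilinearSeries.ofScalars, rising_div_factorial, mul_comm] using h

theorem hasSum_fall_mul_rising_div_factorial (a : ℝ) (j : ℕ) {x : ℝ} (hx : |x| < 1) :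
    HasSum (fun l : ℕ => fall (l : ℝ) j * (rising a l / l.factorial) * x ^ l)
      (rising a j * x ^ j * (1 - x) ^ (-(a + j))) := by
  rw [← hasSum_nat_add_iff' j, Finset.sum_eq_zero, sub_zero]
  · refine ((hasSum_rising_div_factorial (a + j) hx).mul_left (rising a j * x ^ j)).congr_fun ?_
    intro m
    have h := Nat.factorial_mul_descFactorial (Nat.le_add_left j m)
    rw [Nat.add_sub_cancel] at h
    rw [fall_natCast, ← h, add_comm m j, rising_add, pow_add]
    have : ((j + m).descFactorial j : ℝ) ≠ 0 := by
      exact_mod_cast (Nat.descFactorial_pos.mpr (Nat.le_add_right j m)).ne'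
    push_cast
    field_simp
  · intro l hl
    rw [fall_natCast, Nat.descFactorial_eq_zero_iff_lt.mpr (Finset.mem_range.mp hl)]
    simp

theorem rchoose_sub_eq_rising (lam : ℝ) (n : ℕ) :
    rchoose (n - lam) n = rising (1 - lam) n / n.factorial := by
  rw [rchoose, rising, ← Finset.prod_range_reflect]
  congr 1
  refine Finset.prod_congr rfl fun i hi => ?_
  have h : n = (n - 1 - i) + i + 1 := by have := Finset.mem_range.mp hi; omega
  have h' : (n : ℝ) = ((n - 1 - i : ℕ) : ℝ) + i + 1 := by exact_mod_cast h
  linarith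

theorem mul_degH (lam : ℝ) (n : ℕ) :
    lam * degH lam n = 1 - rising (1 - lam) n / n.factorial := by
  induction n with
  | zero => simp [degH, rising]
  | succ n ih =>
    have h : degH lam (n + 1) =
        degH lam n + 1 / ((n : ℝ) + 1) * (rising (1 - lam) n / n.factorial) := by
      rw [← rchoose_sub_eq_rising, degH, Finset.sum_Icc_succ_top (Nat.le_add_left 1 n), degH]
      push_cast
      simp
    rw [h, mul_add, ih, rising_succ, Nat.factorial_succ]
    push_cast
    field_simp
    ring

/-- The generating function of `(l)_j H_{l,λ}`. -/
theorem hasSum_fall_mul_degH {lam : ℝ} (hlam : lam ≠ 0) (j : ℕ) {x : ℝ} (hx : |x| < 1) :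
    HasSum (fun l : ℕ => fall (l : ℝ) j * degH lam l * x ^ l)
      (1 / (1 - x) * (degH lam j * j.factorial * (x / (1 - x)) ^ j
        - ((1 - x) ^ lam - 1) / lam * (rising (1 - lam) j * (x / (1 - x)) ^ j))) := by
  have h1 : 0 < 1 - x := by linarith [(abs_lt.mp hx).2]
  have hd (l : ℕ) : degH lam l = (1 - rising (1 - lam) l / l.factorial) / lam := by
    rw [← mul_degH]; field_simp
  have hs := ((hasSum_fall_mul_rising_div_factorial 1 j hx).sub
    (hasSum_fall_mul_rising_div_factorial (1 - lam) j hx)).div_const lam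
  have e1 : (1 - x) ^ (-(1 + (j : ℝ))) = 1 / (1 - x) ^ (j + 1) := by
    rw [Real.rpow_neg h1.le, add_comm, ← Nat.cast_succ, Real.rpow_natCast, one_div]
  have e2 : (1 - x) ^ (-(1 - lam + (j : ℝ))) = (1 - x) ^ lam / (1 - x) ^ (j + 1) := by
    rw [show -(1 - lam + (j : ℝ)) = lam + -(1 + (j : ℝ)) by ring, Real.rpow_add h1, e1]
    ring
  rw [e1, e2] at hs
  convert! hs using 1
  · funext l
    rw [hd, rising_one, div_self (by positivity)]
    ring
  · rw [hd, rising_one, div_pow, pow_succ]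
    have := h1.ne'
    field_simp
    ring

/-- The generating function of partial sums. -/
theorem hasSum_sum_range_succ_mul_pow {a : ℕ → ℝ} {s x : ℝ} (hx : |x| < 1)
    (h : HasSum (fun l => a l * x ^ l) s) :
    HasSum (fun n => (∑ l ∈ Finset.range (n + 1), a l) * x ^ n) (1 / (1 - x) * s) := by
  have hg : Summable fun n : ℕ => ‖x ^ n‖ := by
    simpa using summable_geometric_of_lt_one (abs_nonneg x) hx
  have ht := hasSum_sum_range_mul_of_summable_norm h.summable.norm hg
  rw [h.tsum_eq, tsum_geometric_of_norm_lt_one (by simpa using hx)] at ht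
  convert! ht using 1
  · funext n
    rw [Finset.sum_mul]
    refine Finset.sum_congr rfl fun l hl => ?_
    rw [mul_assoc, ← pow_add, Nat.add_sub_of_le (Nat.lt_succ_iff.mp (Finset.mem_range.mp hl))]
  · rw [one_div, mul_comm]

theorem stmt10 (lam : ℝ) (hlam : lam ≠ 0) (k : ℕ) (hk : 1 ≤ k) (x : ℝ) (hx : |x| < 1)
    (S2 : ℕ → ℕ → ℝ)
    (hS2 : ∀ (m : ℕ) (z : ℝ), degFall lam z m = ∑ j ∈ Finset.range (m + 1), S2 m j * fall z j) :
    Summable (fun n : ℕ =>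
      |(∑ l ∈ Finset.Icc 1 n, degFall lam (l : ℝ) k * degH lam l) * x ^ n|) ∧
    ∑' n : ℕ, (∑ l ∈ Finset.Icc 1 n, degFall lam (l : ℝ) k * degH lam l) * x ^ n
      = (1 / (1 - x) ^ 2) *
          (HFpoly lam S2 k (x / (1 - x))
            - (((1 - x) ^ lam - 1) / lam) * Fpoly lam S2 k (x / (1 - x))) := by
  have range_eq (f : ℕ → ℝ) (hf : f 0 = 0) (n : ℕ) :
      ∑ l ∈ Finset.Icc 1 n, f l = ∑ l ∈ Finset.range (n + 1), f l := by
    rw [Finset.sum_range_succ', hf, add_zero, Finset.range_eq_Ico, Finset.sum_Ico_add' f 0 n 1]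
    rfl
  have degH_zero : degH lam 0 = 0 := by simp [degH]
  have key : HasSum (fun l : ℕ => degFall lam (l : ℝ) k * degH lam l * x ^ l)
      (1 / (1 - x) * (HFpoly lam S2 k (x / (1 - x))
        - (((1 - x) ^ lam - 1) / lam) * Fpoly lam S2 k (x / (1 - x)))) := by
    convert! hasSum_sum (s := Finset.range (k + 1)) fun j _ =>
      (hasSum_fall_mul_degH hlam j hx).mul_left (S2 k j) using 1
    · funext l
      rw [hS2, Finset.sum_mul, Finset.sum_mul]
      exact Finset.sum_congr rfl fun j _ => by ring
    · rw [HFpoly, Fpoly, range_eq _ (by simp [degH_zero]), Finset.mul_sum,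
        ← Finset.sum_sub_distrib, Finset.mul_sum]
      exact Finset.sum_congr rfl fun j _ => by ring
  have hsum := hasSum_sum_range_succ_mul_pow hx key
  simp only [← range_eq (fun l : ℕ => degFall lam (l : ℝ) k * degH lam l)
    (by simp [degH_zero])] at hsum
  refine ⟨hsum.summable.abs, hsum.tsum_eq.trans ?_⟩
  rw [← mul_assoc, one_div_mul_one_div, ← sq]
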